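/- Let D ⊆ ℝⁿ be a nonempty convex set and Γ = (Γ₁, …, Γ_p) : D → ℝᵖ a vector-valued function such that each component Γ_k is locally Lipschitz on D and admits a bounded convexificator ∂Γ_k(x) at every x ∈ D. Then Γ is strictly ∂-convex on D (i.e., each Γ_k is strictly ∂-convex on D) if and only if the convexificator map is strictly monotone on D, i.e., for all x, y ∈ D with x ≠ y, every k, and all ζ ∈ ∂Γ_k(x), ξ ∈ ∂Γ_k(y), one has ⟨ζ − ξ, x − y⟩ > 0. -/

import Mathlib

open RealInnerProductSpace

/-- Lower Dini derivative of `f` at `x` in direction `w` (limit `λ → 0⁺`), valued in `EReal`. -/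
noncomputable def diniLower {n : ℕ} (f : EuclideanSpace ℝ (Fin n) → ℝ)
    (x w : EuclideanSpace ℝ (Fin n)) : EReal :=
  Filter.liminf (fun t : ℝ => (((f (x + t • w) - f x) / t : ℝ) : EReal))
    (nhdsWithin 0 (Set.Ioi 0))

/-- Upper Dini derivative of `f` at `x` in direction `w` (limit `λ → 0⁺`), valued in `EReal`. -/
noncomputable def diniUpperD {n : ℕ} (f : EuclideanSpace ℝ (Fin n) → ℝ)
    (x w : EuclideanSpace ℝ (Fin n)) : EReal :=
  Filter.limsup (fun t : ℝ => (((f (x + t • w) - f x) / t : ℝ) : EReal))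
    (nhdsWithin 0 (Set.Ioi 0))

/-- `S` is a convexificator of `f` at `x`. -/
def IsConvexificatorAt {n : ℕ} (f : EuclideanSpace ℝ (Fin n) → ℝ)
    (x : EuclideanSpace ℝ (Fin n)) (S : Set (EuclideanSpace ℝ (Fin n))) : Prop :=
  IsClosed S ∧
    (∀ w, diniLower f x w ≤ ⨆ ζ ∈ S, ((⟪ζ, w⟫ : ℝ) : EReal)) ∧
    (∀ w, (⨅ ζ ∈ S, ((⟪ζ, w⟫ : ℝ) : EReal)) ≤ diniUpperD f x w)

/-- `f` admits the bounded convexificator `sub x` at every point `x` of `D`. -/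
def HasBoundedConvexificatorOn {n : ℕ} (D : Set (EuclideanSpace ℝ (Fin n)))
    (f : EuclideanSpace ℝ (Fin n) → ℝ)
    (sub : EuclideanSpace ℝ (Fin n) → Set (EuclideanSpace ℝ (Fin n))) : Prop :=
  ∀ x ∈ D, IsConvexificatorAt f x (sub x) ∧ Bornology.IsBounded (sub x)

/-- `f` is locally Lipschitz on `D`. -/
def LocallyLipschitzOnD {n : ℕ} (D : Set (EuclideanSpace ℝ (Fin n)))
    (f : EuclideanSpace ℝ (Fin n) → ℝ) : Prop :=
  ∀ x ∈ D, ∃ M > (0 : ℝ), ∃ δ > (0 : ℝ), ∀ y ∈ D, ∀ z ∈ D,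
    ‖y - x‖ < δ → ‖z - x‖ < δ → |f y - f z| ≤ M * ‖y - z‖

/-- `f` is `∂`-convex on `D` w.r.t. the convexificator map `sub`. -/
def DConvexOn {n : ℕ} (D : Set (EuclideanSpace ℝ (Fin n)))
    (f : EuclideanSpace ℝ (Fin n) → ℝ)
    (sub : EuclideanSpace ℝ (Fin n) → Set (EuclideanSpace ℝ (Fin n))) : Prop :=
  ∀ ω ∈ D, ∀ v ∈ D, ∀ ζ ∈ sub ω, ⟪ζ, v - ω⟫ ≤ f v - f ω

/-- `f` is strictly `∂`-convex on `D` w.r.t. the convexificator map `sub`. -/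
def StrictDConvexOn {n : ℕ} (D : Set (EuclideanSpace ℝ (Fin n)))
    (f : EuclideanSpace ℝ (Fin n) → ℝ)
    (sub : EuclideanSpace ℝ (Fin n) → Set (EuclideanSpace ℝ (Fin n))) : Prop :=
  ∀ ω ∈ D, ∀ v ∈ D, v ≠ ω → ∀ ζ ∈ sub ω, ⟪ζ, v - ω⟫ < f v - f ω

lemma LocallyLipschitzOnD.continuousOn {n : ℕ} {D : Set (EuclideanSpace ℝ (Fin n))}
    {f : EuclideanSpace ℝ (Fin n) → ℝ} (hf : LocallyLipschitzOnD D f) : ContinuousOn f D := by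
  intro x hx
  obtain ⟨M, hM, δ, hδ, h⟩ := hf x hx
  rw [Metric.continuousWithinAt_iff]
  intro ε hε
  refine ⟨min δ (ε / M), by positivity, fun y hy hyx => ?_⟩
  rw [dist_eq_norm, lt_min_iff] at hyx
  rw [Real.dist_eq]
  calc |f y - f x| ≤ M * ‖y - x‖ := h y hy x hx hyx.1 (by simpa using hδ)
    _ < M * (ε / M) := by gcongr; exact hyx.2
    _ = ε := by field_simp

/-- Mean value inequality for a continuous function whose upper right Dini derivative is bounded
below by `m` in the interior of `[a, b]`. -/
lemma mul_sub_le_image_sub_of_frequently_lt_slope_right {g : ℝ → ℝ} {a b m : ℝ} (hab : a < b)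
    (hg : ContinuousOn g (Set.Icc a b))
    (hslope : ∀ s ∈ Set.Ioo a b, ∀ r < m, ∃ᶠ z in nhdsWithin s (Set.Ioi s), r < slope g s z) :
    m * (b - a) ≤ g b - g a := by
  have key : ∀ s ∈ Set.Ioo a b, m * (b - s) ≤ g b - g s := by
    intro s hs
    have := image_le_of_liminf_slope_right_le_deriv_boundary (f := fun t => -g t) (a := s) (b := b)
      (B := fun t => -g s - m * (t - s)) (B' := fun _ => -m)
      (hg.neg.mono (Set.Icc_subset_Icc_left hs.1.le)) (by simp) (by fun_prop)
      (fun t _ => by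
        have h := (((hasDerivAt_id t).sub_const s).const_mul m).const_sub (-g s)
        simpa using h.hasDerivWithinAt)
      (fun t ht r hr => by
        refine (hslope t ⟨hs.1.trans_le ht.1, ht.2⟩ (-r) (by linarith)).mono fun z hz => ?_
        rw [slope_def_field] at hz ⊢
        have : (-g z - -g t) / (z - t) = -((g z - g t) / (z - t)) := by ring
        linarith)
      (Set.right_mem_Icc.2 hs.2.le)
    linarith
  have hmem : a ∈ closure (Set.Ioo a b) := by
    rw [closure_Ioo hab.ne]
    exact Set.left_mem_Icc.2 hab.le
  refine ContinuousWithinAt.closure_le hmem (f := fun s => m * (b - s)) (g := fun s => g b - g s)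
    (by fun_prop) ?_ key
  exact continuousWithinAt_const.sub
    ((hg a (Set.left_mem_Icc.2 hab.le)).mono Set.Ioo_subset_Icc_self)

lemma IsConvexificatorAt.nonempty {n : ℕ} {f : EuclideanSpace ℝ (Fin n) → ℝ}
    {x : EuclideanSpace ℝ (Fin n)} {S : Set (EuclideanSpace ℝ (Fin n))}
    (h : IsConvexificatorAt f x S) : S.Nonempty := by
  by_contra hS
  rw [Set.not_nonempty_iff_eq_empty] at hS
  simpa [hS, diniLower] using h.2.1 0

lemma IsConvexificatorAt.frequently_lt_slope {n : ℕ} {f : EuclideanSpace ℝ (Fin n) → ℝ}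
    {x w : EuclideanSpace ℝ (Fin n)} {S : Set (EuclideanSpace ℝ (Fin n))} {s m r : ℝ}
    (h : IsConvexificatorAt f (x + s • w) S) (hm : ∀ ζ ∈ S, m ≤ ⟪ζ, w⟫) (hr : r < m) :
    ∃ᶠ z in nhdsWithin s (Set.Ioi s), r < slope (fun t : ℝ => f (x + t • w)) s z := by
  have hle : (m : EReal) ≤ diniUpperD f (x + s • w) w :=
    (le_iInf₂ fun ζ hζ => EReal.coe_le_coe_iff.2 (hm ζ hζ)).trans (h.2.2 w)
  have hfreq := Filter.frequently_lt_of_lt_limsup (by isBoundedDefault)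
    ((EReal.coe_lt_coe_iff.2 hr).trans_le hle)
  have htend : Filter.Tendsto (fun t : ℝ => s + t) (nhdsWithin 0 (Set.Ioi 0))
      (nhdsWithin s (Set.Ioi s)) := by
    refine tendsto_nhdsWithin_iff.2 ⟨?_, ?_⟩
    · refine Filter.Tendsto.mono_left ?_ nhdsWithin_le_nhds
      simpa using (continuous_const_add s).tendsto 0
    · filter_upwards [self_mem_nhdsWithin] with t ht
      simpa using ht
  refine htend.frequently (hfreq.mono fun t ht => ?_)
  rw [EReal.coe_lt_coe_iff] at ht
  simpa [slope_def_field, add_smul, add_assoc] using ht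

lemma StrictDConvexOn.inner_sub_pos {n : ℕ} {D : Set (EuclideanSpace ℝ (Fin n))}
    {f : EuclideanSpace ℝ (Fin n) → ℝ}
    {sub : EuclideanSpace ℝ (Fin n) → Set (EuclideanSpace ℝ (Fin n))}
    (hf : StrictDConvexOn D f sub) {x y ζ ξ : EuclideanSpace ℝ (Fin n)} (hx : x ∈ D) (hy : y ∈ D)
    (hxy : x ≠ y) (hζ : ζ ∈ sub x) (hξ : ξ ∈ sub y) : 0 < ⟪ζ - ξ, x - y⟫ := by
  have h₁ := hf x hx y hy hxy.symm ζ hζ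
  have h₂ := hf y hy x hx hxy ξ hξ
  rw [← neg_sub x y, inner_neg_right] at h₁
  rw [inner_sub_left]
  linarith

lemma dConvexOn_of_strictMono {n : ℕ} {D : Set (EuclideanSpace ℝ (Fin n))}
    (hconv : Convex ℝ D) {f : EuclideanSpace ℝ (Fin n) → ℝ}
    {sub : EuclideanSpace ℝ (Fin n) → Set (EuclideanSpace ℝ (Fin n))}
    (hf : ContinuousOn f D) (hcf : ∀ x ∈ D, IsConvexificatorAt f x (sub x))
    (hmono : ∀ x ∈ D, ∀ y ∈ D, x ≠ y → ∀ ζ ∈ sub x, ∀ ξ ∈ sub y, 0 < ⟪ζ - ξ, x - y⟫) :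
    DConvexOn D f sub := by
  intro x hx y hy ζ hζ
  rcases eq_or_ne y x with rfl | hne
  · simp
  have hmem : ∀ s ∈ Set.Icc (0 : ℝ) 1, x + s • (y - x) ∈ D :=
    fun s hs => hconv.add_smul_sub_mem hx hy hs
  have hw : y - x ≠ 0 := sub_ne_zero.2 hne
  have h := mul_sub_le_image_sub_of_frequently_lt_slope_right
    (g := fun t : ℝ => f (x + t • (y - x))) (m := ⟪ζ, y - x⟫) zero_lt_one
    (hf.comp (by fun_prop) hmem) (fun s hs r hr => by
      have hsD := hmem s (Set.Ioo_subset_Icc_self hs)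
      refine (hcf _ hsD).frequently_lt_slope (fun ξ hξ => ?_) hr
      have hpos := hmono _ hsD x hx (by simpa using ⟨hs.1.ne', hw⟩) ξ hξ ζ hζ
      rw [add_sub_cancel_left, inner_smul_right] at hpos
      have := pos_of_mul_pos_right hpos hs.1.le
      rw [inner_sub_left] at this
      linarith)
  simpa using h

lemma strictDConvexOn_of_strictMono {n : ℕ} {D : Set (EuclideanSpace ℝ (Fin n))}
    (hconv : Convex ℝ D) {f : EuclideanSpace ℝ (Fin n) → ℝ}
    {sub : EuclideanSpace ℝ (Fin n) → Set (EuclideanSpace ℝ (Fin n))}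
    (hf : ContinuousOn f D) (hcf : ∀ x ∈ D, IsConvexificatorAt f x (sub x))
    (hmono : ∀ x ∈ D, ∀ y ∈ D, x ≠ y → ∀ ζ ∈ sub x, ∀ ξ ∈ sub y, 0 < ⟪ζ - ξ, x - y⟫) :
    StrictDConvexOn D f sub := by
  have hd := dConvexOn_of_strictMono hconv hf hcf hmono
  intro x hx y hy hne ζ hζ
  have hzD : midpoint ℝ x y ∈ D := hconv.midpoint_mem hx hy
  obtain ⟨ξ, hξ⟩ := (hcf _ hzD).nonempty
  have hzx : midpoint ℝ x y - x = (2⁻¹ : ℝ) • (y - x) := by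
    rw [midpoint_sub_left, invOf_eq_inv]
  have hyz : y - midpoint ℝ x y = (2⁻¹ : ℝ) • (y - x) := by
    rw [right_sub_midpoint, invOf_eq_inv]
  have h₁ := hd x hx _ hzD ζ hζ
  have h₂ := hd _ hzD y hy ξ hξ
  have h₃ := hmono _ hzD x hx (by simpa using hne.symm) ξ hξ ζ hζ
  rw [hzx, inner_smul_right] at h₁ h₃
  rw [hyz, inner_smul_right] at h₂
  rw [inner_sub_left] at h₃
  linarith

theorem stmt_10 {n p : ℕ} (D : Set (EuclideanSpace ℝ (Fin n)))
    (hne : D.Nonempty) (hconv : Convex ℝ D)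
    (Γ : Fin p → EuclideanSpace ℝ (Fin n) → ℝ)
    (sub : Fin p → EuclideanSpace ℝ (Fin n) → Set (EuclideanSpace ℝ (Fin n)))
    (hlip : ∀ k, LocallyLipschitzOnD D (Γ k))
    (hcf : ∀ k, HasBoundedConvexificatorOn D (Γ k) (sub k)) :
    (∀ k, StrictDConvexOn D (Γ k) (sub k)) ↔
      (∀ x ∈ D, ∀ y ∈ D, x ≠ y → ∀ k, ∀ ζ ∈ sub k x, ∀ ξ ∈ sub k y,
        0 < ⟪ζ - ξ, x - y⟫) := by
  refine ⟨fun h x hx y hy hxy k ζ hζ ξ hξ => (h k).inner_sub_pos hx hy hxy hζ hξ, fun h k => ?_⟩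
  exact strictDConvexOn_of_strictMono hconv (hlip k).continuousOn (fun x hx => (hcf k x hx).1)
    fun x hx y hy hxy ζ hζ ξ hξ => h x hx y hy hxy k ζ hζ ξ hξ
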